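/- There are absolute positive constants η and α such that for every positive integer k and every l ≤ α k, the probability (with respect to P) that there exists some a ∈ F_l^k with |(k^{-1} Σ_{j=1}^k (Σ_{i=1}^k a_i ε_{i,j})²)^{1/2} − E_2(a)| > E_2(a)/4 is at most e^{−η k}. -/

import Mathlib

open Finset

/-- The sign `±1` associated to a boolean. -/
noncomputable def sgn (b : Bool) : ℝ := if b then 1 else -1

open scoped Classical in
/-- The probability, under the uniform measure on sign arrays
`{ε_{i,j}}_{i,j=1}^k ∈ {−1,1}^{k²}`, of an event `pred`. -/
noncomputable def signProb (k : ℕ) (pred : (Fin k → Fin k → Bool) → Prop) : ℝ :=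
  ((Finset.univ : Finset (Fin k → Fin k → Bool)).filter pred).card / 2 ^ (k * k)

/-- `E_2(a)`: the average over all sign arrays of `(k⁻¹ ∑_j (∑_i a_i ε_{i,j})²)^{1/2}`. -/
noncomputable def E2 (k : ℕ) (a : Fin k → ℝ) : ℝ :=
  (∑ ε : Fin k → Fin k → Bool,
      Real.sqrt ((k : ℝ)⁻¹ * ∑ j, (∑ i, a i * sgn (ε i j)) ^ 2)) / 2 ^ (k * k)

open scoped Classical in
/-- `F_l^k`: vectors in the Euclidean unit ball of `ℝ^k` with at most `l` nonzero
coordinates. -/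
noncomputable def Flk (k l : ℕ) : Set (Fin k → ℝ) :=
  {a | (∑ i, a i ^ 2) ≤ 1 ∧ (Finset.univ.filter fun i => a i ≠ 0).card ≤ l}

theorem sum_cons {n : ℕ} (f : (Fin (n+1) → Bool) → ℝ) :
    ∑ v, f v = ∑ v : Fin n → Bool, (f (Fin.cons true v) + f (Fin.cons false v)) := by
  rw [← (Fin.consEquiv (fun _ : Fin (n+1) => Bool)).sum_comp, Fintype.sum_prod_type,
    Fintype.sum_bool, ← Finset.sum_add_distrib]
  rfl

theorem Y_cons {n : ℕ} (a : Fin (n+1) → ℝ) (b : Bool) (v : Fin n → Bool) :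
    ∑ i, a i * sgn ((Fin.cons b v : Fin (n+1) → Bool) i)
      = a 0 * sgn b + ∑ i, a i.succ * sgn (v i) := by
  rw [Fin.sum_univ_succ]; simp

theorem mom2 (n : ℕ) (a : Fin n → ℝ) :
    ∑ v : Fin n → Bool, (∑ i, a i * sgn (v i)) ^ 2 = 2 ^ n * ∑ i, a i ^ 2 := by
  induction n with
  | zero => simp
  | succ n ih =>
    rw [sum_cons]
    simp only [Y_cons]
    have h : ∀ v : Fin n → Bool, (a 0 * sgn true + ∑ i, a i.succ * sgn (v i)) ^ 2
        + (a 0 * sgn false + ∑ i, a i.succ * sgn (v i)) ^ 2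
        = 2 * (∑ i, a i.succ * sgn (v i)) ^ 2 + 2 * a 0 ^ 2 := by
      intro v; simp only [sgn]; simp; ring
    simp only [h]
    rw [Finset.sum_add_distrib, ← Finset.mul_sum, ih (fun i => a i.succ), Fin.sum_univ_succ]
    simp
    ring

theorem mom4 (n : ℕ) (a : Fin n → ℝ) :
    ∑ v : Fin n → Bool, (∑ i, a i * sgn (v i)) ^ 4 ≤ 2 ^ n * (3 * (∑ i, a i ^ 2) ^ 2) := by
  induction n with
  | zero => simp
  | succ n ih =>
    rw [sum_cons]
    simp only [Y_cons]
    have h : ∀ v : Fin n → Bool, (a 0 * sgn true + ∑ i, a i.succ * sgn (v i)) ^ 4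
        + (a 0 * sgn false + ∑ i, a i.succ * sgn (v i)) ^ 4
        = 2 * (∑ i, a i.succ * sgn (v i)) ^ 4 + 12 * a 0 ^ 2 * (∑ i, a i.succ * sgn (v i)) ^ 2
          + 2 * a 0 ^ 4 := by
      intro v; simp only [sgn]; simp; ring
    simp only [h]
    rw [Finset.sum_add_distrib, Finset.sum_add_distrib, ← Finset.mul_sum, ← Finset.mul_sum,
      mom2 n (fun i => a i.succ), Fin.sum_univ_succ]
    have := ih (fun i => a i.succ)
    simp only [Finset.sum_const, Finset.card_univ, Fintype.card_pi, Fintype.card_bool,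
      Finset.prod_const, Fintype.card_fin, nsmul_eq_mul]
    push_cast
    have h2 : (0:ℝ) ≤ 2 ^ n * a 0 ^ 4 := by positivity
    rw [pow_succ (2:ℝ) n]
    nlinarith

theorem mgf_lin (n : ℕ) (a : Fin n → ℝ) (s : ℝ) :
    ∑ v : Fin n → Bool, Real.exp (s * ∑ i, a i * sgn (v i))
      ≤ 2 ^ n * Real.exp (s ^ 2 / 2 * ∑ i, a i ^ 2) := by
  induction n with
  | zero => simp
  | succ n ih =>
    rw [sum_cons]
    simp only [Y_cons]
    have h : ∀ v : Fin n → Bool, Real.exp (s * (a 0 * sgn true + ∑ i, a i.succ * sgn (v i)))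
        + Real.exp (s * (a 0 * sgn false + ∑ i, a i.succ * sgn (v i)))
        = 2 * Real.cosh (s * a 0) * Real.exp (s * ∑ i, a i.succ * sgn (v i)) := by
      intro v; simp only [sgn, Real.cosh_eq, mul_add, Real.exp_add]; simp; ring
    simp only [h]
    rw [← Finset.mul_sum, Fin.sum_univ_succ, mul_add, Real.exp_add]
    have h1 := Real.cosh_le_exp_half_sq (s * a 0)
    have h2 := ih (fun i => a i.succ)
    have h3 : (s * a 0) ^ 2 / 2 = s ^ 2 / 2 * a 0 ^ 2 := by ring
    rw [h3] at h1
    calc _ ≤ 2 * Real.exp (s ^ 2 / 2 * a 0 ^ 2) *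
          (2 ^ n * Real.exp (s ^ 2 / 2 * ∑ i : Fin n, a i.succ ^ 2)) := by gcongr
      _ = _ := by ring

theorem mgf_low (n : ℕ) (a : Fin n → ℝ) (ha : ∑ i, a i ^ 2 = 1) (c : ℝ) (hc : 0 ≤ c) :
    ∑ v : Fin n → Bool, Real.exp (-c * (∑ i, a i * sgn (v i)) ^ 2)
      ≤ 2 ^ n * Real.exp (-c + 3 * c ^ 2 / 2) := by
  have key : ∀ x : ℝ, 0 ≤ x → Real.exp (-x) ≤ 1 - x + x ^ 2 / 2 := by
    intro x hx
    have h1 := Real.quadratic_le_exp_of_nonneg hx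
    rw [Real.exp_neg, inv_le_comm₀ (Real.exp_pos _) (by nlinarith [sq_nonneg (x-1)])]
    refine le_trans ?_ h1
    rw [inv_le_iff_one_le_mul₀ (by nlinarith [sq_nonneg (x-1)])]
    nlinarith [pow_nonneg hx 4]
  have h2 := mom2 n a
  have h4 := mom4 n a
  rw [ha] at h2 h4
  calc _ ≤ ∑ v : Fin n → Bool, (1 - c * (∑ i, a i * sgn (v i)) ^ 2
            + c ^ 2 / 2 * (∑ i, a i * sgn (v i)) ^ 4) := by
        apply Finset.sum_le_sum
        intro v _
        have := key (c * (∑ i, a i * sgn (v i)) ^ 2) (by positivity)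
        rw [neg_mul]
        refine this.trans (le_of_eq (by ring))
    _ = 2 ^ n - c * 2 ^ n + c ^ 2 / 2 * ∑ v : Fin n → Bool, (∑ i, a i * sgn (v i)) ^ 4 := by
        rw [Finset.sum_add_distrib, Finset.sum_sub_distrib, ← Finset.mul_sum, ← Finset.mul_sum, h2]
        simp
    _ ≤ 2 ^ n - c * 2 ^ n + c ^ 2 / 2 * (2 ^ n * (3 * 1 ^ 2)) := by gcongr
    _ = 2 ^ n * ((-c + 3 * c ^ 2 / 2) + 1) := by ring
    _ ≤ _ := by gcongr; exact Real.add_one_le_exp _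

open MeasureTheory ProbabilityTheory in
theorem mgf_up (n : ℕ) (a : Fin n → ℝ) (ha : ∑ i, a i ^ 2 = 1) :
    ∑ v : Fin n → Bool, Real.exp (0.095 * (∑ i, a i * sgn (v i)) ^ 2)
      ≤ 2 ^ n * (10 / 9) := by
  set s : ℝ := Real.sqrt 0.19 with hs
  have hs2 : s ^ 2 = 0.19 := Real.sq_sqrt (by norm_num)
  have hG : ∀ c : ℝ, Integrable (fun x => Real.exp (-(x ^ 2) / 2 + c * x)) ∧
      ∫ x, Real.exp (-(x ^ 2) / 2 + c * x) = √(2 * Real.pi) * Real.exp (c ^ 2 / 2) := by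
    intro c
    have e : (fun x : ℝ => Real.exp (-(x ^ 2) / 2 + c * x))
        = fun x => Real.exp (c ^ 2 / 2) * Real.exp (-(1/2) * (x - c) ^ 2) := by
      funext x; rw [← Real.exp_add]; congr 1; ring
    rw [e]
    refine ⟨((integrable_exp_neg_mul_sq (by norm_num : (0:ℝ) < 1/2)).comp_sub_right c).const_mul _, ?_⟩
    rw [integral_const_mul, integral_sub_right_eq_self (fun x => Real.exp (-(1/2) * x ^ 2)) c,
      integral_gaussian, mul_comm]
    congr 2; ring
  have hI : Integrable (fun x : ℝ => Real.exp (-0.405 * x ^ 2)) :=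
    integrable_exp_neg_mul_sq (by norm_num)
  have hpos : 0 < √(2 * Real.pi) := Real.sqrt_pos.2 (by positivity)
  have h1 : √(2 * Real.pi) * ∑ v : Fin n → Bool, Real.exp (0.095 * (∑ i, a i * sgn (v i)) ^ 2)
      = ∫ x, ∑ v : Fin n → Bool, Real.exp (-(x ^ 2) / 2 + (s * ∑ i, a i * sgn (v i)) * x) := by
    rw [integral_finsetSum _ (fun v _ => (hG _).1), Finset.mul_sum]
    refine Finset.sum_congr rfl fun v _ => ?_
    rw [(hG _).2, mul_pow, hs2]; congr 2; ring
  have h2 : ∫ x, ∑ v : Fin n → Bool, Real.exp (-(x ^ 2) / 2 + (s * ∑ i, a i * sgn (v i)) * x)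
      ≤ ∫ x, 2 ^ n * Real.exp (-0.405 * x ^ 2) := by
    refine integral_mono (integrable_finsetSum _ (fun v _ => (hG _).1)) (hI.const_mul _) ?_
    intro x
    have := mgf_lin n a (s * x)
    simp only [Real.exp_add]
    rw [← Finset.mul_sum]
    have e : ∀ v : Fin n → Bool, (s * ∑ i, a i * sgn (v i)) * x = s * x * ∑ i, a i * sgn (v i) := by
      intro v; ring
    simp only [e]
    refine (mul_le_mul_of_nonneg_left this (Real.exp_pos _).le).trans (le_of_eq ?_)
    rw [mul_left_comm, ← Real.exp_add, ha, mul_pow, hs2]; congr 2; ring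
  rw [← h1, integral_const_mul, integral_gaussian] at h2
  have h3 : √(Real.pi / 0.405) = √(2 * Real.pi) * (10 / 9) := by
    rw [show Real.pi / 0.405 = (2 * Real.pi) * (10/9) ^ 2 by ring, Real.sqrt_mul (by positivity),
      Real.sqrt_sq (by norm_num)]
  rw [h3] at h2
  have : √(2 * Real.pi) * ∑ v : Fin n → Bool, Real.exp (0.095 * (∑ i, a i * sgn (v i)) ^ 2)
      ≤ √(2 * Real.pi) * (2 ^ n * (10 / 9)) := by linarith
  exact le_of_mul_le_mul_left this hpos

noncomputable def QQ (k : ℕ) (a : Fin k → ℝ) (ε : Fin k → Fin k → Bool) : ℝ :=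
  ∑ j, (∑ i, a i * sgn (ε i j)) ^ 2

theorem sum_exp_Q (k : ℕ) (a : Fin k → ℝ) (c : ℝ) :
    ∑ ε, Real.exp (c * QQ k a ε)
      = (∑ v : Fin k → Bool, Real.exp (c * (∑ i, a i * sgn (v i)) ^ 2)) ^ k := by
  rw [Fintype.sum_pow, ← (Equiv.piComm (fun _ _ : Fin k => Bool)).sum_comp]
  refine Finset.sum_congr rfl fun ε _ => ?_
  rw [QQ, Finset.mul_sum, Real.exp_sum]
  rfl

theorem up_tail (k : ℕ) (a : Fin k → ℝ) (ha : ∑ i, a i ^ 2 = 1) :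
    ∑ ε, Real.exp (0.095 * (QQ k a ε - 1.21 * k)) ≤ 2 ^ (k * k) * Real.exp (-0.004 * k) := by
  have e : ∀ ε, Real.exp (0.095 * (QQ k a ε - 1.21 * k))
      = Real.exp (0.095 * QQ k a ε) * Real.exp (-0.11495) ^ k := by
    intro ε; rw [← Real.exp_nat_mul, ← Real.exp_add]; congr 1; ring
  simp only [e]
  rw [← Finset.sum_mul, sum_exp_Q, ← mul_pow, pow_mul, mul_comm (-0.004 : ℝ), Real.exp_nat_mul,
    ← mul_pow]
  have h := mgf_up k a ha
  have h1 : (10/9 : ℝ) ≤ Real.exp 0.11 := by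
    have := Real.quadratic_le_exp_of_nonneg (by norm_num : (0:ℝ) ≤ 0.11)
    refine le_trans ?_ this; norm_num
  apply pow_le_pow_left₀ (by positivity)
  calc _ ≤ 2 ^ k * Real.exp 0.11 * Real.exp (-0.11495) := by gcongr; exact h.trans (by gcongr)
    _ = 2 ^ k * Real.exp (0.11 + -0.11495) := by rw [Real.exp_add]; ring
    _ ≤ _ := by gcongr; norm_num

theorem low_tail (k : ℕ) (a : Fin k → ℝ) (ha : ∑ i, a i ^ 2 = 1) (c u : ℝ) (hc : 0 ≤ c) :
    ∑ ε, Real.exp (c * (u * k - QQ k a ε))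
      ≤ 2 ^ (k * k) * Real.exp ((c * u - c + 3 * c ^ 2 / 2) * k) := by
  have e : ∀ ε, Real.exp (c * (u * k - QQ k a ε))
      = Real.exp (-c * QQ k a ε) * Real.exp (c * u) ^ k := by
    intro ε; rw [← Real.exp_nat_mul, ← Real.exp_add]; congr 1; ring
  simp only [e]
  rw [← Finset.sum_mul, sum_exp_Q, ← mul_pow, pow_mul, mul_comm _ (k : ℝ), Real.exp_nat_mul,
    ← mul_pow]
  have h := mgf_low k a ha c hc
  apply pow_le_pow_left₀ (by positivity)
  calc _ ≤ 2 ^ k * Real.exp (-c + 3 * c ^ 2 / 2) * Real.exp (c * u) := by gcongr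
    _ = _ := by rw [mul_assoc, ← Real.exp_add]; congr 2; ring

noncomputable def nrm {k : ℕ} (a : Fin k → ℝ) : ℝ := Real.sqrt (∑ i, a i ^ 2)

theorem nrm_nonneg {k : ℕ} (a : Fin k → ℝ) : 0 ≤ nrm a := Real.sqrt_nonneg _

theorem nrm_sq {k : ℕ} (a : Fin k → ℝ) : nrm a ^ 2 = ∑ i, a i ^ 2 :=
  Real.sq_sqrt (Finset.sum_nonneg fun _ _ => sq_nonneg _)

theorem nrm_eq {k : ℕ} (a : Fin k → ℝ) : nrm a = ‖WithLp.toLp 2 a‖ := by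
  rw [EuclideanSpace.norm_eq]; simp [nrm]

theorem nrm_add {k : ℕ} (a b : Fin k → ℝ) : nrm (a + b) ≤ nrm a + nrm b := by
  simp only [nrm_eq, WithLp.toLp_add]; exact norm_add_le _ _

theorem nrm_smul {k : ℕ} (c : ℝ) (a : Fin k → ℝ) : nrm (c • a) = |c| * nrm a := by
  simp only [nrm_eq, WithLp.toLp_smul, norm_smul, Real.norm_eq_abs]

theorem nrm_pos {k : ℕ} (a : Fin k → ℝ) (h : a ≠ 0) : 0 < nrm a := by
  rw [nrm_eq, norm_pos_iff]; simpa using h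

theorem abs_round_le (x : ℝ) : |(round x : ℝ)| ≤ 2 * |x| := by
  by_cases h : round x = 0
  · simp [h]
  · have h1 : (1:ℝ) ≤ |(round x : ℝ)| := by exact_mod_cast Int.one_le_abs h
    have h2 := abs_sub_round x
    have h3 := abs_sub_abs_le_abs_sub (round x : ℝ) x
    rw [abs_sub_comm] at h3
    linarith

/-- sparse rounding -/
theorem rounding {k l : ℕ} (hl : 0 < l) (a : Fin k → ℝ) (ha : nrm a = 1)
    (hs : (Finset.univ.filter fun i => a i ≠ 0).card ≤ l) :
    ∃ (m : Fin k → ℤ) (h : ℝ), 0 < h ∧ ∑ i, m i ^ 2 ≤ 1600 * (l : ℤ) ∧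
      nrm (a - h • (fun i => (m i : ℝ))) ≤ 0.025 ∧
      (∀ i, a i = 0 → (a - h • (fun i => (m i : ℝ))) i = 0) := by
  have hl' : (0:ℝ) < l := by exact_mod_cast hl
  set w : ℝ := Real.sqrt l with hw
  have hwp : 0 < w := Real.sqrt_pos.2 hl'
  have hw2 : w ^ 2 = l := Real.sq_sqrt hl'.le
  have hsum : ∑ i, a i ^ 2 = 1 := by rw [← nrm_sq, ha]; norm_num
  refine ⟨fun i => round (20 * w * a i), (20 * w)⁻¹, by positivity, ?_, ?_, ?_⟩
  · have : (∑ i, (round (20 * w * a i) : ℝ) ^ 2) ≤ 1600 * l := by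
      calc _ ≤ ∑ i, 1600 * l * a i ^ 2 := by
            apply Finset.sum_le_sum
            intro i _
            have := abs_round_le (20 * w * a i)
            have h2 := pow_le_pow_left₀ (abs_nonneg _) this 2
            rw [sq_abs, mul_pow, sq_abs] at h2
            refine h2.trans (le_of_eq ?_)
            rw [← hw2]; ring
        _ = _ := by rw [← Finset.mul_sum, hsum, mul_one]
    exact_mod_cast this
  · have : ∑ i, (a - (20 * w)⁻¹ • (fun i => (round (20 * w * a i) : ℝ))) i ^ 2 ≤ 0.025 ^ 2 := by
      calc _ ≤ ∑ i, (if a i ≠ 0 then 0.025 ^ 2 / (l:ℝ) else 0) := by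
            apply Finset.sum_le_sum
            intro i _
            by_cases h : a i = 0
            · simp [h]
            · simp only [ne_eq, h, not_false_eq_true, if_true]
              have h2 := abs_sub_round (20 * w * a i)
              have h3 := pow_le_pow_left₀ (abs_nonneg _) h2 2
              rw [sq_abs] at h3
              simp only [Pi.sub_apply, Pi.smul_apply, smul_eq_mul]
              rw [le_div_iff₀ hl', ← hw2]
              have : (a i - (20 * w)⁻¹ * (round (20 * w * a i) : ℝ)) ^ 2 * w ^ 2
                = (20 * w * a i - (round (20 * w * a i) : ℝ)) ^ 2 / 400 := by
                field_simp; ring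
              rw [this]; linarith
        _ ≤ _ := by
            rw [← Finset.sum_filter, Finset.sum_const, nsmul_eq_mul]
            have : ((Finset.univ.filter fun i => a i ≠ 0).card : ℝ) ≤ l := by exact_mod_cast hs
            calc _ ≤ (l:ℝ) * (0.025 ^ 2 / (l:ℝ)) := by gcongr
              _ = _ := by field_simp
    rw [nrm]
    exact Real.sqrt_le_iff.2 ⟨by norm_num, this⟩
  · intro i h; simp [h]

theorem det {k l : ℕ} (hl : 0 < l) (N : (Fin k → ℝ) → ℝ) (K : ℝ)
    (hadd : ∀ x y, N (x + y) ≤ N x + N y) (hsm : ∀ c x, N (c • x) = |c| * N x)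
    (hK : ∀ x, N x ≤ K * nrm x)
    (hnet : ∀ m : Fin k → ℤ, ∑ i, m i ^ 2 ≤ 1600 * (l : ℤ) →
      0.9 * nrm (fun i => (m i : ℝ)) ≤ N (fun i => (m i : ℝ)) ∧
      N (fun i => (m i : ℝ)) ≤ 1.1 * nrm (fun i => (m i : ℝ)))
    (a : Fin k → ℝ) (ha : nrm a = 1)
    (hs : (Finset.univ.filter fun i => a i ≠ 0).card ≤ l) :
    0.84 ≤ N a ∧ N a ≤ 1.16 := by
  set S : Set ℝ := {x | ∃ a : Fin k → ℝ, nrm a = 1 ∧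
    (Finset.univ.filter fun i => a i ≠ 0).card ≤ l ∧ x = N a} with hS
  have hbdd : BddAbove S := ⟨K, by
    rintro x ⟨b, hb, -, rfl⟩
    have := hK b
    rwa [hb, mul_one] at this⟩
  have hne : S.Nonempty := ⟨_, a, ha, hs, rfl⟩
  set A := sSup S with hA
  have hA1 : ∀ b : Fin k → ℝ, (Finset.univ.filter fun i => b i ≠ 0).card ≤ l →
      N b ≤ A * nrm b := by
    intro b hb
    by_cases h0 : b = 0
    · subst h0
      have := hsm 0 0
      have h2 : nrm (0 : Fin k → ℝ) = 0 := by simp [nrm]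
      simp at this
      rw [this, h2]; simp
    · have hp := nrm_pos b h0
      have : N ((nrm b)⁻¹ • b) ≤ A := by
        apply le_csSup hbdd
        refine ⟨_, ?_, ?_, rfl⟩
        · rw [nrm_smul, abs_of_pos (inv_pos.2 hp)]; field_simp
        · refine le_trans (Finset.card_le_card ?_) hb
          intro i; simp
      rw [hsm, abs_of_pos (inv_pos.2 hp), inv_mul_le_iff₀ hp] at this
      linarith
  have main : ∀ b : Fin k → ℝ, nrm b = 1 → (Finset.univ.filter fun i => b i ≠ 0).card ≤ l →
      0 ≤ A → N b ≤ 1.1 * 1.025 + 0.025 * A ∧ 0.9 * 0.975 - 0.025 * A ≤ N b := by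
    intro b hb hbs hA0
    obtain ⟨m, h, hh, hm1, hm2, hm3⟩ := rounding hl b hb hbs
    set c : Fin k → ℝ := fun i => (m i : ℝ) with hc
    obtain ⟨n1, n2⟩ := hnet m hm1
    have hd : N (b - h • c) ≤ A * nrm (b - h • c) := by
      apply hA1
      refine le_trans (Finset.card_le_card ?_) hbs
      intro i
      simp only [Finset.mem_filter, Finset.mem_univ, true_and]
      exact fun h1 h2 => h1 (hm3 i h2)
    have hd' : N (b - h • c) ≤ 0.025 * A := by nlinarith
    have hneg : N (h • c - b) = N (b - h • c) := by
      have := hsm (-1) (b - h • c)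
      simpa using this
    have hneg2 : nrm (h • c - b) = nrm (b - h • c) := by
      have := nrm_smul (-1) (b - h • c)
      simpa using this
    have e1 := hadd (h • c) (b - h • c)
    have e2 := hadd b (h • c - b)
    have e3 := nrm_add (h • c) (b - h • c)
    have e4 := nrm_add b (h • c - b)
    simp only [add_sub_cancel] at e1 e2 e3 e4
    have s1 := hsm h c
    have s2 := nrm_smul h c
    rw [abs_of_pos hh] at s1 s2
    have n1' := mul_le_mul_of_nonneg_left n1 hh.le
    have n2' := mul_le_mul_of_nonneg_left n2 hh.le
    constructor
    · nlinarith
    · nlinarith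
  have hN0 : 0 ≤ N a := by
    have h1 := hadd a (-a)
    have h2 := hsm (-1) a
    have h3 := hsm 0 0
    simp at h1 h2 h3
    linarith
  have hA0 : 0 ≤ A := hN0.trans (le_csSup hbdd ⟨a, ha, hs, rfl⟩)
  have hAle : A ≤ 1.1 * 1.025 + 0.025 * A := by
    apply csSup_le hne
    rintro x ⟨b, hb, hbs, rfl⟩
    exact (main b hb hbs hA0).1
  obtain ⟨f1, f2⟩ := main a ha hs hA0
  constructor <;> linarith

theorem netsum (M : ℕ) : ∑ m ∈ Finset.Icc (-(M:ℤ)) M, (1/5000:ℝ) ^ m.natAbs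
    ≤ 1 + 3/5000 - 3 * (1/5000) ^ (M+1) := by
  induction M with
  | zero => simp; norm_num
  | succ M ih =>
    have e : Finset.Icc (-((M+1:ℕ):ℤ)) ((M+1:ℕ):ℤ)
        = insert ((M+1:ℕ):ℤ) (insert (-((M+1:ℕ):ℤ)) (Finset.Icc (-(M:ℤ)) M)) := by
      ext x; simp only [Finset.mem_Icc, Finset.mem_insert]; omega
    rw [e, Finset.sum_insert, Finset.sum_insert, Int.natAbs_neg, Int.natAbs_natCast,
      pow_succ _ (M+1)]
    · have : (0:ℝ) < (1/5000)^(M+1) := by positivity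
      linarith
    · simp
    · simp only [Finset.mem_Icc, Finset.mem_insert]; omega

noncomputable def net (k L : ℕ) : Finset (Fin k → ℤ) :=
  (Fintype.piFinset fun _ => Finset.Icc (-(L:ℤ)) L).filter (fun m => ∑ i, m i ^ 2 ≤ (L:ℤ))

theorem natAbs_le_sq (x : ℤ) : (x.natAbs : ℤ) ≤ x ^ 2 := by
  rw [← Int.natAbs_sq]
  have : x.natAbs ≤ x.natAbs ^ 2 := Nat.le_self_pow (by norm_num) _
  exact_mod_cast this

theorem mem_net (k L : ℕ) (m : Fin k → ℤ) (h : ∑ i, m i ^ 2 ≤ (L:ℤ)) : m ∈ net k L := by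
  simp only [net, Finset.mem_filter, Fintype.mem_piFinset, Finset.mem_Icc]
  refine ⟨fun i => ?_, h⟩
  have h1 := natAbs_le_sq (m i)
  have h2 : m i ^ 2 ≤ ∑ i, m i ^ 2 :=
    Finset.single_le_sum (f := fun i => m i ^ 2) (fun i _ => sq_nonneg _) (Finset.mem_univ i)
  omega

theorem net_card (k L : ℕ) : ((net k L).card : ℝ) ≤ 5000 ^ L * (1 + 3/5000) ^ k := by
  have h1 : ∀ m ∈ net k L, (1:ℝ) ≤ 5000 ^ L * ∏ i, (1/5000:ℝ) ^ (m i).natAbs := by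
    intro m hm
    have hm := (Finset.mem_filter.1 hm).2
    have : ∑ i, (m i).natAbs ≤ L := by
      have h := Finset.sum_le_sum (fun i (_ : i ∈ Finset.univ) => natAbs_le_sq (m i))
      have h := h.trans hm
      exact_mod_cast h
    rw [Finset.prod_pow_eq_pow_sum]
    calc (1:ℝ) = 5000 ^ L * (1/5000) ^ L := by rw [← mul_pow]; norm_num
      _ ≤ _ := by
        gcongr ?_ * ?_
        exact pow_le_pow_of_le_one (by norm_num) (by norm_num) this
  calc ((net k L).card : ℝ) = ∑ m ∈ net k L, (1:ℝ) := by simp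
    _ ≤ ∑ m ∈ net k L, 5000 ^ L * ∏ i, (1/5000:ℝ) ^ (m i).natAbs := Finset.sum_le_sum h1
    _ ≤ ∑ m ∈ Fintype.piFinset (fun _ : Fin k => Finset.Icc (-(L:ℤ)) L),
          5000 ^ L * ∏ i, (1/5000:ℝ) ^ (m i).natAbs := by
        apply Finset.sum_le_sum_of_subset_of_nonneg (Finset.filter_subset _ _)
        intros; positivity
    _ = 5000 ^ L * (∑ m ∈ Finset.Icc (-(L:ℤ)) L, (1/5000:ℝ) ^ m.natAbs) ^ k := by
        rw [← Finset.mul_sum, Finset.sum_prod_piFinset (Finset.Icc (-(L:ℤ)) L)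
          (fun _ m => (1/5000:ℝ) ^ m.natAbs)]
        simp
    _ ≤ _ := by
        gcongr
        have := netsum L
        have h : (0:ℝ) < (1/5000)^(L+1) := by positivity
        linarith

theorem markov (k : ℕ) (p : (Fin k → Fin k → Bool) → Prop) (f : (Fin k → Fin k → Bool) → ℝ)
    (h0 : ∀ ε, 0 ≤ f ε) (h1 : ∀ ε, p ε → 1 ≤ f ε) :
    signProb k p ≤ (∑ ε, f ε) / 2 ^ (k * k) := by
  classical
  unfold signProb
  gcongr
  rw [Finset.card_eq_sum_ones]
  push_cast
  calc _ ≤ ∑ ε ∈ Finset.univ.filter p, f ε := by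
        refine le_trans (le_of_eq ?_) (Finset.sum_le_sum (f := fun _ => (1:ℝ)) fun ε h => h1 ε (Finset.mem_filter.1 h).2)
        congr
    _ ≤ _ := Finset.sum_le_sum_of_subset_of_nonneg (Finset.filter_subset _ _)
        (fun ε _ _ => h0 ε)

noncomputable def NN (k : ℕ) (ε : Fin k → Fin k → Bool) (a : Fin k → ℝ) : ℝ :=
  Real.sqrt ((k : ℝ)⁻¹ * QQ k a ε)

theorem NN_eq (k : ℕ) (ε : Fin k → Fin k → Bool) (a : Fin k → ℝ) :
    NN k ε a = Real.sqrt (k : ℝ)⁻¹ * nrm (fun j => ∑ i, a i * sgn (ε i j)) := by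
  rw [NN, Real.sqrt_mul (by positivity)]; rfl

theorem NN_add (k : ℕ) (ε : Fin k → Fin k → Bool) (a b : Fin k → ℝ) :
    NN k ε (a + b) ≤ NN k ε a + NN k ε b := by
  simp only [NN_eq]
  rw [← mul_add]
  gcongr
  refine le_trans (le_of_eq ?_) (nrm_add _ _)
  congr 1
  funext j
  simp [add_mul, Finset.sum_add_distrib]

theorem NN_smul (k : ℕ) (ε : Fin k → Fin k → Bool) (c : ℝ) (a : Fin k → ℝ) :
    NN k ε (c • a) = |c| * NN k ε a := by
  simp only [NN_eq]
  rw [mul_left_comm, ← nrm_smul]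
  congr 2
  funext j
  simp [Finset.mul_sum, mul_assoc]

theorem QQ_le (k : ℕ) (ε : Fin k → Fin k → Bool) (a : Fin k → ℝ) :
    QQ k a ε ≤ (k * k) * nrm a ^ 2 := by
  have h : ∀ j, (∑ i, a i * sgn (ε i j)) ^ 2 ≤ k * nrm a ^ 2 := by
    intro j
    have := Finset.sum_mul_sq_le_sq_mul_sq Finset.univ a (fun i => sgn (ε i j))
    have e : ∑ i, (sgn (ε i j)) ^ 2 = k := by
      have : ∀ i, (sgn (ε i j)) ^ 2 = 1 := by intro i; unfold sgn; split_ifs <;> norm_num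
      simp [this]
    rw [e, ← nrm_sq] at this
    linarith
  calc _ ≤ ∑ j : Fin k, k * nrm a ^ 2 := Finset.sum_le_sum fun j _ => h j
    _ = _ := by simp; ring

theorem NN_le (k : ℕ) (ε : Fin k → Fin k → Bool) (a : Fin k → ℝ) :
    NN k ε a ≤ Real.sqrt ((k:ℝ)⁻¹ * (k * k)) * nrm a := by
  have e : √((k:ℝ)⁻¹ * (k * k)) * nrm a = √((k:ℝ)⁻¹ * ((k * k) * nrm a ^ 2)) := by
    rw [← mul_assoc _ _ (nrm a ^ 2), Real.sqrt_mul (by positivity) (nrm a ^ 2), Real.sqrt_sq (nrm_nonneg a)]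
  rw [NN, e]
  gcongr
  exact QQ_le k ε a

theorem E2_eq (k : ℕ) (a : Fin k → ℝ) : E2 k a = (∑ ε, NN k ε a) / 2 ^ (k * k) := rfl

theorem E2_smul (k : ℕ) (c : ℝ) (a : Fin k → ℝ) : E2 k (c • a) = |c| * E2 k a := by
  simp only [E2_eq, NN_smul]; rw [← Finset.mul_sum, mul_div_assoc]

theorem card_arr (k : ℕ) (c : ℝ) : ∑ _ε : Fin k → Fin k → Bool, c = 2 ^ (k * k) * c := by
  simp [pow_mul]

theorem E2_le (k : ℕ) (hk : 0 < k) (a : Fin k → ℝ) (ha : ∑ i, a i ^ 2 = 1) : E2 k a ≤ 1.1 := by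
  have hk' : (0:ℝ) < k := by exact_mod_cast hk
  rw [E2_eq, div_le_iff₀ (by positivity)]
  have hup := up_tail k a ha
  have h1 : ∀ ε, NN k ε a ≤ 1.1 + (k:ℝ)⁻¹ / (2.2 * 0.095) *
      (Real.exp (0.095 * (QQ k a ε - 1.21 * k)) - 1) := by
    intro ε
    have h := Real.add_one_le_exp (0.095 * (QQ k a ε - 1.21 * k))
    have hq : 0 ≤ QQ k a ε := Finset.sum_nonneg fun _ _ => sq_nonneg _
    have hs := Real.sq_sqrt (show 0 ≤ (k:ℝ)⁻¹ * QQ k a ε by positivity)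
    have h2 : NN k ε a ≤ ((k:ℝ)⁻¹ * QQ k a ε + 1.21) / 2.2 := by
      unfold NN
      have := sq_nonneg (Real.sqrt ((k:ℝ)⁻¹ * QQ k a ε) - 1.1)
      rw [sub_sq, hs] at this
      rw [le_div_iff₀ (by norm_num)]
      norm_num at this ⊢
      linarith
    calc _ ≤ _ := h2
      _ = 1.1 + (k:ℝ)⁻¹ / (2.2 * 0.095) * (0.095 * (QQ k a ε - 1.21 * k)) := by
        field_simp; ring
      _ ≤ _ := by gcongr; linarith
  refine (Finset.sum_le_sum fun ε _ => h1 ε).trans ?_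
  rw [Finset.sum_add_distrib, ← Finset.mul_sum, Finset.sum_sub_distrib, card_arr, card_arr]
  have h3 : ∑ ε, Real.exp (0.095 * (QQ k a ε - 1.21 * k)) - 2 ^ (k*k) * 1 ≤ 0 := by
    have : Real.exp (-0.004 * k) ≤ 1 := Real.exp_le_one_iff.2 (by nlinarith)
    have := mul_le_mul_of_nonneg_left this (show (0:ℝ) ≤ 2 ^ (k*k) by positivity)
    linarith
  have h4 : (k:ℝ)⁻¹ / (2.2 * 0.095) * (∑ ε, Real.exp (0.095 * (QQ k a ε - 1.21 * k)) - 2 ^ (k*k) * 1) ≤ 0 :=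
    mul_nonpos_of_nonneg_of_nonpos (by positivity) h3
  linarith

theorem le_E2 (k : ℕ) (hk : (10:ℝ) ^ 8 ≤ k) (a : Fin k → ℝ) (ha : ∑ i, a i ^ 2 = 1) :
    0.95 ≤ E2 k a := by
  have hk' : (0:ℝ) < k := by linarith [show (0:ℝ) < 10 ^ 8 by norm_num]
  rw [E2_eq, le_div_iff₀ (by positivity)]
  have hlow := low_tail k a ha 0.02 0.9604 (by norm_num)
  have h1 : ∀ ε, 0.98 * (1 - Real.exp (0.02 * (0.9604 * k - QQ k a ε))) ≤ NN k ε a := by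
    intro ε
    by_cases h : 0.9604 * k ≤ QQ k a ε
    · have : 0.98 ≤ NN k ε a := by
        apply Real.le_sqrt_of_sq_le
        rw [inv_mul_eq_div, le_div_iff₀ hk']
        norm_num at h ⊢; linarith
      have := Real.exp_pos (0.02 * (0.9604 * k - QQ k a ε))
      linarith
    · have : 1 ≤ Real.exp (0.02 * (0.9604 * k - QQ k a ε)) := Real.one_le_exp (by linarith)
      have : 0 ≤ NN k ε a := Real.sqrt_nonneg _
      linarith
  refine le_trans ?_ (Finset.sum_le_sum fun ε _ => h1 ε)
  rw [← Finset.mul_sum, Finset.sum_sub_distrib, card_arr]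
  have h2 : Real.exp ((0.02 * 0.9604 - 0.02 + 3 * 0.02 ^ 2 / 2) * k) ≤ 0.02 := by
    have h3 : (0.02 * 0.9604 - 0.02 + 3 * 0.02 ^ 2 / 2) * (k:ℝ) ≤ -(100:ℝ) := by
      have hk : (100000000:ℝ) ≤ k := by linarith
      norm_num; linarith
    refine (Real.exp_le_exp.2 h3).trans ?_
    rw [Real.exp_neg]
    have := Real.add_one_le_exp (100:ℝ)
    rw [inv_le_comm₀ (Real.exp_pos _) (by norm_num)]
    norm_num at this ⊢; linarith
  have := mul_le_mul_of_nonneg_left h2 (show (0:ℝ) ≤ 2 ^ (k*k) by positivity)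
  have : (0:ℝ) < 2 ^ (k*k) := by positivity
  linarith

theorem unit_sq {k : ℕ} (a : Fin k → ℝ) (h : a ≠ 0) :
    ∑ i, ((nrm a)⁻¹ • a) i ^ 2 = 1 := by
  have hp := nrm_pos a h
  rw [← nrm_sq, nrm_smul, abs_of_pos (inv_pos.2 hp)]; field_simp

noncomputable def ff (k L : ℕ) (ε : Fin k → Fin k → Bool) : ℝ :=
  ∑ m ∈ (net k L).filter (fun m => m ≠ 0),
    (Real.exp (0.095 * (QQ k ((nrm fun i => (m i : ℝ))⁻¹ • fun i => (m i : ℝ)) ε - 1.21 * k))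
    + Real.exp (0.06 * (0.81 * k - QQ k ((nrm fun i => (m i : ℝ))⁻¹ • fun i => (m i : ℝ)) ε)))

theorem cast_ne {k : ℕ} (m : Fin k → ℤ) (h : m ≠ 0) : (fun i => (m i : ℝ)) ≠ 0 := by
  intro h'; apply h; funext i
  have := congrFun h' i
  simpa using this

theorem sum_ff (k L : ℕ) : (∑ ε, ff k L ε) / 2 ^ (k * k)
    ≤ 5000 ^ L * (1 + 3/5000) ^ k * (2 * Real.exp (-0.004 * k)) := by
  rw [div_le_iff₀ (by positivity)]
  unfold ff
  rw [Finset.sum_comm]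
  calc _ ≤ ∑ m ∈ (net k L).filter (fun m => m ≠ 0),
        (2 * Real.exp (-0.004 * k)) * 2 ^ (k * k) := by
        apply Finset.sum_le_sum
        intro m hm
        have hu := unit_sq _ (cast_ne m (Finset.mem_filter.1 hm).2)
        rw [Finset.sum_add_distrib]
        have h1 := up_tail k _ hu
        have h2 := low_tail k _ hu 0.06 0.81 (by norm_num)
        have h3 : Real.exp ((0.06 * 0.81 - 0.06 + 3 * 0.06 ^ 2 / 2) * k)
            ≤ Real.exp (-0.004 * k) := by
          gcongr; norm_num
        have h4 := mul_le_mul_of_nonneg_left h3 (show (0:ℝ) ≤ 2 ^ (k*k) by positivity)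
        linarith
    _ = (((net k L).filter (fun m => m ≠ 0)).card : ℝ) *
        ((2 * Real.exp (-0.004 * k)) * 2 ^ (k * k)) := by
        rw [Finset.sum_const, nsmul_eq_mul]
    _ ≤ ((net k L).card : ℝ) * ((2 * Real.exp (-0.004 * k)) * 2 ^ (k * k)) := by
        gcongr; exact Finset.filter_subset _ _
    _ ≤ _ := by
        rw [← mul_assoc]
        gcongr
        exact net_card k L

theorem good_net (k L : ℕ) (hk : 0 < k) (ε : Fin k → Fin k → Bool) (hf : ff k L ε < 1)
    (m : Fin k → ℤ) (hm : ∑ i, m i ^ 2 ≤ (L:ℤ)) :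
    0.9 * nrm (fun i => (m i : ℝ)) ≤ NN k ε (fun i => (m i : ℝ)) ∧
      NN k ε (fun i => (m i : ℝ)) ≤ 1.1 * nrm (fun i => (m i : ℝ)) := by
  have hk' : (0:ℝ) < k := by exact_mod_cast hk
  by_cases h0 : m = 0
  · subst h0
    simp [nrm, NN, QQ]
  have hp := nrm_pos _ (cast_ne m h0)
  have hmem : m ∈ (net k L).filter (fun m => m ≠ 0) := Finset.mem_filter.2 ⟨mem_net k L m hm, h0⟩
  have hle := (Finset.single_le_sum (f := fun m : Fin k → ℤ =>
    (Real.exp (0.095 * (QQ k ((nrm fun i => (m i : ℝ))⁻¹ • fun i => (m i : ℝ)) ε - 1.21 * k))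
    + Real.exp (0.06 * (0.81 * k - QQ k ((nrm fun i => (m i : ℝ))⁻¹ • fun i => (m i : ℝ)) ε))))
    (fun i _ => by positivity) hmem).trans_lt hf
  set c : Fin k → ℝ := fun i => (m i : ℝ) with hc
  have hs := NN_smul k ε (nrm c)⁻¹ c
  rw [abs_of_pos (inv_pos.2 hp), inv_mul_eq_div] at hs
  set q := QQ k ((nrm c)⁻¹ • c) ε with hq
  have p1 := Real.exp_pos (0.095 * (q - 1.21 * k))
  have p2 := Real.exp_pos (0.06 * (0.81 * k - q))
  have l1 : 0.095 * (q - 1.21 * k) < 0 := by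
    rw [← Real.exp_lt_one_iff]; linarith
  have l2 : 0.06 * (0.81 * k - q) < 0 := by
    rw [← Real.exp_lt_one_iff]; linarith
  have b1 : 0.9 ≤ NN k ε ((nrm c)⁻¹ • c) := by
    apply Real.le_sqrt_of_sq_le
    rw [inv_mul_eq_div, le_div_iff₀ hk']
    norm_num at l2 ⊢; linarith
  have b2 : NN k ε ((nrm c)⁻¹ • c) ≤ 1.1 := by
    apply Real.sqrt_le_iff.2 ⟨by norm_num, ?_⟩
    rw [inv_mul_eq_div, div_le_iff₀ hk']
    norm_num at l1 ⊢; linarith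
  rw [hs, le_div_iff₀ hp] at b1
  rw [hs, div_le_iff₀ hp] at b2
  exact ⟨b1, b2⟩

theorem numerics (k l : ℕ) (hk : (10:ℝ) ^ 8 ≤ k) (hl : (l:ℝ) ≤ 1 / 10 ^ 8 * k) :
    5000 ^ (1600 * l) * (1 + 3/5000) ^ k * (2 * Real.exp (-0.004 * k))
      ≤ Real.exp (-(0.002 * k)) := by
  have h5 : (5000:ℝ) ≤ Real.exp 9 := by
    have := Real.exp_one_gt_d9
    rw [show (9:ℝ) = (9:ℕ) * 1 by norm_num, Real.exp_nat_mul]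
    calc (5000:ℝ) ≤ 2.7 ^ 9 := by norm_num
      _ ≤ _ := by gcongr; linarith
  have h1 : (5000:ℝ) ^ (1600 * l) ≤ Real.exp ((1600 * l : ℕ) * 9) := by
    rw [Real.exp_nat_mul]; gcongr
  have h2 : (1 + 3/5000:ℝ) ^ k ≤ Real.exp (k * (3/5000)) := by
    rw [Real.exp_nat_mul]; gcongr
    have := Real.add_one_le_exp (3/5000:ℝ)
    linarith
  have h3 : (2:ℝ) ≤ Real.exp 1 := by have := Real.add_one_le_exp (1:ℝ); linarith
  calc _ ≤ Real.exp ((1600 * l : ℕ) * 9) * Real.exp (k * (3/5000)) *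
        (Real.exp 1 * Real.exp (-0.004 * k)) := by gcongr
    _ = Real.exp ((1600 * l : ℕ) * 9 + k * (3/5000) + (1 + -0.004 * k)) := by
        simp only [Real.exp_add]
    _ ≤ _ := by
        gcongr
        push_cast
        have hk : (100000000:ℝ) ≤ k := by linarith
        norm_num at hl ⊢
        linarith

/-- There are absolute positive constants `η` and `α` such that for every positive integer `k`
and every `l ≤ α k`,
`P(∃ a ∈ F_l^k, |(k⁻¹ ∑_j (∑_i a_i ε_{i,j})²)^{1/2} − E₂(a)| > E₂(a)/4) ≤ e^{−η k}`. -/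
theorem stmt4 :
    ∃ η α : ℝ, 0 < η ∧ 0 < α ∧ ∀ k : ℕ, 0 < k → ∀ l : ℕ, (l : ℝ) ≤ α * k →
      signProb k (fun ε => ∃ a ∈ Flk k l,
          |Real.sqrt ((k : ℝ)⁻¹ * ∑ j, (∑ i, a i * sgn (ε i j)) ^ 2) - E2 k a| > E2 k a / 4)
        ≤ Real.exp (-(η * k)) := by
  refine ⟨0.002, 1 / 10 ^ 8, by norm_num, by norm_num, ?_⟩
  intro k hk l hl
  have hk' : (0:ℝ) < k := by exact_mod_cast hk
  change signProb k (fun ε => ∃ a ∈ Flk k l, |NN k ε a - E2 k a| > E2 k a / 4) ≤ _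
  have hzero : ∀ ε, ¬ (|NN k ε 0 - E2 k 0| > E2 k 0 / 4) := by
    intro ε
    have h1 := NN_smul k ε 0 0
    have h2 := E2_smul k 0 0
    simp only [zero_smul, abs_zero, zero_mul] at h1 h2
    simp [h1, h2]
  rcases Nat.eq_zero_or_pos l with h0 | hlp
  · subst h0
    refine (markov k _ (fun _ => 0) (fun _ => le_rfl) ?_).trans ?_
    · rintro ε ⟨a, ⟨-, ha⟩, hb⟩
      exfalso
      have : a = 0 := by
        funext i
        by_contra hi
        have hc := Finset.card_eq_zero.1 (Nat.le_zero.1 ha)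
        have : i ∈ (Finset.univ.filter fun i => a i ≠ 0) := by simpa using hi
        simp_all
      subst this
      exact hzero ε hb
    · simp; positivity
  · have hl1 : (1:ℝ) ≤ l := by exact_mod_cast hlp
    have hkb : (10:ℝ) ^ 8 ≤ k := by linarith
    refine (markov k _ (ff k (1600 * l)) (fun ε => Finset.sum_nonneg fun _ _ => by positivity)
      ?_).trans ((sum_ff k (1600 * l)).trans (numerics k l hkb hl))
    rintro ε ⟨a, ⟨-, ha⟩, hb⟩
    by_contra hf
    push Not at hf
    by_cases h0 : a = 0
    · subst h0; exact hzero ε hb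
    have hp := nrm_pos a h0
    set u := (nrm a)⁻¹ • a with hu
    have hua : a = nrm a • u := by
      rw [hu, smul_smul, mul_inv_cancel₀ hp.ne', one_smul]
    have hu1 := unit_sq a h0
    have hn1 : nrm u = 1 := by
      rw [nrm, hu1, Real.sqrt_one]
    have hsp : (Finset.univ.filter fun i => u i ≠ 0).card ≤ l := by
      refine le_trans (Finset.card_le_card ?_) ha
      intro i; simp [hu]
    obtain ⟨d1, d2⟩ := det hlp (NN k ε) _ (NN_add k ε) (NN_smul k ε) (NN_le k ε)
      (fun m hm => good_net k (1600 * l) hk ε hf m (by push_cast; exact hm)) u hn1 hsp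
    have e1 := E2_le k hk u hu1
    have e2 := le_E2 k hkb u hu1
    rw [hua, NN_smul, E2_smul, ← mul_sub, abs_mul, abs_abs, abs_of_pos hp, mul_div_assoc] at hb
    have hb := lt_of_mul_lt_mul_left hb hp.le
    have : |NN k ε u - E2 k u| ≤ E2 k u / 4 := by
      rw [abs_le]; constructor <;> linarith
    linarith
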